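/- Let n ≥ 3, let C ⊂ Alt(n) be the set of all 3-cycles in Sym(n), and let μ be the measure on Sym(n) given by μ = (1/2)·1_{{e}} + (1/(2|C|))·1_C (so μ is supported on Alt(n) and is constant on conjugacy classes). Let g ∈ Sym(n) \ Alt(n) and define μ'(x) = (1/2)·μ(x) + (1/2)·μ(g⁻¹x). Then for every integer k ≥ 1 and every x ∈ Sym(n): |(μ')^{*k}(x) − 1/n!| ≤ (1/2)·max_{y∈Alt(n)} |μ^{*k}(y) − 2/n!|. In particular, the distance of the μ'-walk on Sym(n) from uniformity is controlled by the distance of the lazy 3-cycle walk on Alt(n) from uniformity. -/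

import Mathlib

open Equiv
open scoped Classical

/-- The set `C` of all 3-cycles in `Sym(n)` (all of which lie in `Alt(n)`). -/
noncomputable def threeCycles (n : ℕ) : Finset (Perm (Fin n)) :=
  Finset.univ.filter (fun x => x.IsThreeCycle)

/-- Convolution of two real-valued functions on a finite group:
`(μ * ν)(x) = ∑_y μ(y)·ν(y⁻¹x)`. -/
noncomputable def conv {G : Type*} [Group G] [Fintype G] (μ ν : G → ℝ) : G → ℝ :=
  fun x => ∑ y : G, μ y * ν (y⁻¹ * x)

/-- `k`-fold convolution power of `μ` (with `μ^{*0}` the point mass at the identity). -/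
noncomputable def convPow {G : Type*} [Group G] [Fintype G] (μ : G → ℝ) : ℕ → G → ℝ
  | 0 => fun x => if x = 1 then 1 else 0
  | k + 1 => conv μ (convPow μ k)

/-- The lazy 3-cycle walk measure `μ = (1/2)·1_{{e}} + (1/(2|C|))·1_C` on `Sym(n)`,
supported on `Alt(n)` and constant on conjugacy classes. -/
noncomputable def lazyMu (n : ℕ) : Perm (Fin n) → ℝ :=
  fun x =>
    (if x = 1 then (1 : ℝ) / 2 else 0) +
      (if x ∈ threeCycles n then 1 / (2 * ((threeCycles n).card : ℝ)) else 0)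

/-- The shifted measure `μ'(x) = (1/2)·μ(x) + (1/2)·μ(g⁻¹x)` on `Sym(n)`. -/
noncomputable def lazyMu' (n : ℕ) (g : Perm (Fin n)) : Perm (Fin n) → ℝ :=
  fun x => (1 / 2) * lazyMu n x + (1 / 2) * lazyMu n (g⁻¹ * x)

section ShiftAverage

variable {G : Type*} [Group G]

/-- The average of `f` and its left translate by `g`, i.e. `(1/2)(δ_e + δ_g) * f`. -/
noncomputable def shiftAvg (g : G) (f : G → ℝ) : G → ℝ :=
  fun x => (1 / 2) * f x + (1 / 2) * f (g⁻¹ * x)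

theorem abs_shiftAvg_sub_le (g : G) {f : G → ℝ} {c M : ℝ} (h : ∀ x, |f x - c| ≤ M) (x : G) :
    |shiftAvg g f x - c| ≤ M := by
  have h₁ := abs_le.mp (h x)
  have h₂ := abs_le.mp (h (g⁻¹ * x))
  rw [shiftAvg, abs_le]
  constructor <;> linarith

theorem abs_iterate_shiftAvg_sub_le (g : G) {f : G → ℝ} {c M : ℝ} (h : ∀ x, |f x - c| ≤ M)
    (k : ℕ) (x : G) : |(shiftAvg g)^[k] f x - c| ≤ M := by
  induction k generalizing x with
  | zero => exact h x
  | succ k ih =>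
    rw [Function.iterate_succ_apply']
    exact abs_shiftAvg_sub_le g ih x

/-- If `f` vanishes off an index-two subgroup `H` and `g ∉ H`, then averaging `f` with its
translate by `g` spreads it over the whole group. -/
theorem abs_shiftAvg_sub_half_le {H : Subgroup G} (hH : H.index = 2) {g : G} (hg : g ∉ H)
    {f : G → ℝ} (hf : ∀ x ∉ H, f x = 0) {c M : ℝ} (h : ∀ x ∈ H, |f x - c| ≤ M) (x : G) :
    |shiftAvg g f x - 1 / 2 * c| ≤ 1 / 2 * M := by
  have hg' : g⁻¹ ∉ H := by rwa [inv_mem_iff]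
  have key : g⁻¹ * x ∈ H ↔ x ∉ H := by
    rw [Subgroup.mul_mem_iff_of_index_two hH]
    tauto
  by_cases hx : x ∈ H
  · have h₁ := abs_le.mp (h x hx)
    rw [shiftAvg, hf (g⁻¹ * x) (by tauto), abs_le]
    constructor <;> linarith
  · have h₁ := abs_le.mp (h _ (key.mpr hx))
    rw [shiftAvg, hf x hx, abs_le]
    constructor <;> linarith

variable [Fintype G]

theorem conv_shiftAvg_left (g : G) (μ ν : G → ℝ) :
    conv (shiftAvg g μ) ν = shiftAvg g (conv μ ν) := by
  funext x
  have h : ∑ y, μ (g⁻¹ * y) * ν (y⁻¹ * x) = ∑ y, μ y * ν (y⁻¹ * (g⁻¹ * x)) :=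
    Fintype.sum_equiv (Equiv.mulLeft g⁻¹) _ _ fun y => by simp [mul_assoc]
  simp only [conv, shiftAvg, add_mul, Finset.sum_add_distrib, mul_assoc (1 / 2 : ℝ),
    ← Finset.mul_sum, h]

theorem conv_shiftAvg_right (g : G) {μ : G → ℝ} (hμ : ∀ y, μ (g⁻¹ * y * g) = μ y) (ν : G → ℝ) :
    conv μ (shiftAvg g ν) = shiftAvg g (conv μ ν) := by
  funext x
  have h : ∑ y, μ y * ν (g⁻¹ * (y⁻¹ * x)) = ∑ y, μ y * ν (y⁻¹ * (g⁻¹ * x)) :=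
    Fintype.sum_equiv (MulAut.conj g⁻¹).toEquiv _ _ fun y => by simp [mul_assoc, ← hμ y]
  simp only [conv, shiftAvg, mul_add, Finset.sum_add_distrib, mul_left_comm _ (1 / 2 : ℝ),
    ← Finset.mul_sum, h]

theorem conv_iterate_shiftAvg_right (g : G) {μ : G → ℝ} (hμ : ∀ y, μ (g⁻¹ * y * g) = μ y)
    (ν : G → ℝ) (k : ℕ) : conv μ ((shiftAvg g)^[k] ν) = (shiftAvg g)^[k] (conv μ ν) := by
  induction k with
  | zero => rfl
  | succ k ih =>
    rw [Function.iterate_succ_apply', Function.iterate_succ_apply', conv_shiftAvg_right g hμ, ih]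

theorem convPow_shiftAvg (g : G) {μ : G → ℝ} (hμ : ∀ y, μ (g⁻¹ * y * g) = μ y) (k : ℕ) :
    convPow (shiftAvg g μ) k = (shiftAvg g)^[k] (convPow μ k) := by
  induction k with
  | zero => rfl
  | succ k ih =>
    rw [convPow, ih, conv_shiftAvg_left, conv_iterate_shiftAvg_right g hμ,
      Function.iterate_succ_apply', convPow]

theorem convPow_eq_zero_of_notMem {H : Subgroup G} {μ : G → ℝ} (hμ : ∀ x ∉ H, μ x = 0) (k : ℕ)
    {x : G} (hx : x ∉ H) : convPow μ k x = 0 := by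
  induction k generalizing x with
  | zero => exact if_neg (by rintro rfl; exact hx H.one_mem)
  | succ k ih =>
    refine Finset.sum_eq_zero fun y _ => ?_
    by_cases hy : y ∈ H
    · rw [ih (by rwa [H.mul_mem_cancel_left (H.inv_mem hy)]), mul_zero]
    · rw [hμ y hy, zero_mul]

end ShiftAverage

theorem lazyMu_conj (n : ℕ) (g y : Perm (Fin n)) : lazyMu n (g⁻¹ * y * g) = lazyMu n y := by
  have h₁ : g⁻¹ * y * g = 1 ↔ y = 1 := by
    simpa using conj_eq_one_iff (a := g⁻¹) (b := y)
  have h₂ : g⁻¹ * y * g ∈ threeCycles n ↔ y ∈ threeCycles n := by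
    have h := Perm.cycleType_conj (σ := y) (τ := g⁻¹)
    rw [inv_inv] at h
    rw [threeCycles, Finset.mem_filter_univ, Finset.mem_filter_univ, Perm.IsThreeCycle, h,
      Perm.IsThreeCycle]
  simp only [lazyMu, h₁, h₂]

theorem lazyMu_eq_zero_of_notMem (n : ℕ) {x : Perm (Fin n)} (hx : x ∉ alternatingGroup (Fin n)) :
    lazyMu n x = 0 := by
  have h₁ : x ≠ 1 := fun h => hx (h ▸ one_mem _)
  have h₂ : x ∉ threeCycles n := fun h =>
    hx (Perm.IsThreeCycle.mem_alternatingGroup (Finset.mem_filter.mp h).2)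
  simp [lazyMu, h₁, h₂]

/-- **The `μ'`-walk on `Sym(n)` is controlled by the lazy 3-cycle walk on `Alt(n)`:**
for `g ∈ Sym(n) \ Alt(n)`, every `k ≥ 1` and every `x ∈ Sym(n)`,
`|(μ')^{*k}(x) − 1/n!| ≤ (1/2)·max_{y ∈ Alt(n)} |μ^{*k}(y) − 2/n!|`. -/
theorem shifted_walk_controlled (n : ℕ) (hn : 3 ≤ n)
    (g : Perm (Fin n)) (hg : g ∉ alternatingGroup (Fin n))
    (k : ℕ) (hk : 1 ≤ k) (x : Perm (Fin n)) :
    |convPow (lazyMu' n g) k x - 1 / (n.factorial : ℝ)| ≤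
      (1 / 2) *
        ⨆ y : alternatingGroup (Fin n),
          |convPow (lazyMu n) k (y : Perm (Fin n)) - 2 / (n.factorial : ℝ)| := by
  have : Nontrivial (Fin n) := Fin.nontrivial_iff_two_le.mpr (by lia)
  have hbound : ∀ y ∈ alternatingGroup (Fin n), |convPow (lazyMu n) k y - 2 / (n.factorial : ℝ)| ≤
      ⨆ y : alternatingGroup (Fin n),
        |convPow (lazyMu n) k (y : Perm (Fin n)) - 2 / (n.factorial : ℝ)| := fun y hy =>
    le_ciSup (f := fun y : alternatingGroup (Fin n) =>
      |convPow (lazyMu n) k (y : Perm (Fin n)) - 2 / (n.factorial : ℝ)|)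
      (Set.finite_range _).bddAbove ⟨y, hy⟩
  have hhalf := abs_shiftAvg_sub_half_le (alternatingGroup.index_eq_two (α := Fin n)) hg
    (fun _ => convPow_eq_zero_of_notMem (fun _ => lazyMu_eq_zero_of_notMem n) k) hbound
  have hc : 1 / (n.factorial : ℝ) = 1 / 2 * (2 / (n.factorial : ℝ)) := by ring
  obtain ⟨j, rfl⟩ : ∃ j, k = j + 1 := ⟨k - 1, by lia⟩
  change |convPow (shiftAvg g (lazyMu n)) (j + 1) x - _| ≤ _
  rw [convPow_shiftAvg g (lazyMu_conj n g), Function.iterate_succ_apply, hc]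
  exact abs_iterate_shiftAvg_sub_le g hhalf j x
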